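/- arXiv:2604.08949 — 6 statements merged into one kernel-verified Lean document; each statement's English description precedes it below -/
import Mathlib

section
/- Let d ≥ 1, let γ > 0, and let u ∈ ℝ^d be a unit vector (‖u‖ = 1). Then for every t ∈ ℝ, the integral of the isotropic multivariate Cauchy density over the closed half-space {n ∈ ℝ^d : ⟪u, n⟫ ≥ t} equals 1/2 − (1/π)·arctan(t/γ), i.e. ∫_{{n : ⟪u,n⟫ ≥ t}} f_γ(n) dn = 1/2 − (1/π)·arctan(t/γ). -/
open MeasureTheory Real Filter
open scoped RealInnerProductSpace Topology

noncomputable def cC (d : ℕ) : ℝ :=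
  Real.Gamma (((d : ℝ) + 1) / 2) / Real.pi ^ (((d : ℝ) + 1) / 2)

noncomputable def fC (d : ℕ) (γ : ℝ) (n : EuclideanSpace ℝ (Fin d)) : ℝ :=
  cC d * γ ^ (-(d : ℝ)) * (1 + ‖n‖ ^ 2 / γ ^ 2) ^ (-(((d : ℝ) + 1) / 2))

theorem lintegral_rpow_mul_exp_neg_mul_Ioi {s r : ℝ} (hs : 0 < s) (hr : 0 < r) :
    ∫⁻ x in Set.Ioi (0 : ℝ), ENNReal.ofReal (x ^ (s - 1) * exp (-(r * x)))
      = ENNReal.ofReal ((1 / r) ^ s * Real.Gamma s) := by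
  have h := Real.integral_rpow_mul_exp_neg_mul_Ioi hs hr
  have hpos : 0 < (1 / r) ^ s * Real.Gamma s := by
    have := Real.Gamma_pos_of_pos hs
    positivity
  rw [← h, ofReal_integral_eq_lintegral_ofReal]
  · exact Integrable.of_integral_ne_zero (h ▸ hpos.ne')
  · filter_upwards [ae_restrict_mem measurableSet_Ioi] with x hx
    have : (0 : ℝ) < x := hx
    simp only [Pi.zero_apply]
    positivity

theorem integrable_exp_neg_mul_sq_norm {V : Type*} [NormedAddCommGroup V]
    [InnerProductSpace ℝ V] [FiniteDimensional ℝ V] [MeasurableSpace V] [BorelSpace V]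
    {a : ℝ} (ha : 0 < a) : Integrable fun v : V => exp (-a * ‖v‖ ^ 2) := by
  refine Integrable.of_integral_ne_zero ?_
  rw [GaussianFourier.integral_rexp_neg_mul_sq_norm ha]
  positivity

theorem EuclideanSpace.exists_orthonormalBasis_zero_eq {m : ℕ}
    {u : EuclideanSpace ℝ (Fin (m + 1))} (hu : ‖u‖ = 1) :
    ∃ b : OrthonormalBasis (Fin (m + 1)) ℝ (EuclideanSpace ℝ (Fin (m + 1))), b 0 = u := by
  have hv : Orthonormal ℝ (({0} : Set (Fin (m + 1))).domRestrict fun _ => u) :=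
    ⟨fun _ => hu, fun i j hij => absurd (Subsingleton.elim i j) hij⟩
  obtain ⟨b, hb⟩ := hv.exists_orthonormalBasis_extension_of_card_eq (by simp)
  exact ⟨b, hb 0 rfl⟩

theorem setIntegral_halfSpace_exp_neg_mul_sq_norm {m : ℕ} {a : ℝ}
    {u : EuclideanSpace ℝ (Fin (m + 1))} (hu : ‖u‖ = 1) (t : ℝ) :
    ∫ n in {n : EuclideanSpace ℝ (Fin (m + 1)) | ⟪u, n⟫ ≥ t}, exp (-a * ‖n‖ ^ 2)
      = √(π / a) ^ m * ∫ r in Set.Ici t, exp (-a * r ^ 2) := by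
  obtain ⟨b, rfl⟩ := EuclideanSpace.exists_orthonormalBasis_zero_eq hu
  let f : Fin (m + 1) → ℝ → ℝ :=
    Fin.cons ((Set.Ici t).indicator fun r => exp (-a * r ^ 2)) fun _ r => exp (-a * r ^ 2)
  have hprod := integral_fintype_prod_volume_eq_prod f
  simp only [Fin.prod_univ_succ, f, Fin.cons_zero, Fin.cons_succ, integral_gaussian,
    Finset.prod_const, Finset.card_univ, Fintype.card_fin,
    integral_indicator measurableSet_Ici] at hprod
  rw [mul_comm, ← hprod,
    ← (PiLp.volume_preserving_ofLp (Fin (m + 1))).integral_comp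
      (MeasurableEquiv.toLp 2 (Fin (m + 1) → ℝ)).symm.measurableEmbedding,
    ← b.measurePreserving_repr.integral_comp
      b.repr.toHomeomorph.measurableEmbedding,
    ← integral_indicator (measurableSet_le measurable_const (by fun_prop))]
  refine integral_congr_ae (.of_forall fun n => ?_)
  have hn : ‖n‖ ^ 2 = b.repr n 0 ^ 2 + ∑ i : Fin m, b.repr n i.succ ^ 2 := by
    rw [← b.repr.norm_map n, EuclideanSpace.real_norm_sq_eq, Fin.sum_univ_succ]
  simp only [Set.indicator_apply, Set.mem_ofPred_eq, Set.mem_Ici, ← b.repr_apply_apply]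
  split_ifs
  · rw [← Real.exp_sum, ← Real.exp_add, hn, mul_add, Finset.mul_sum]
  · simp

theorem setLIntegral_halfSpace_exp_neg_mul_sq_norm {m : ℕ} {a : ℝ} (ha : 0 < a)
    {u : EuclideanSpace ℝ (Fin (m + 1))} (hu : ‖u‖ = 1) (t : ℝ) :
    ∫⁻ n in {n : EuclideanSpace ℝ (Fin (m + 1)) | ⟪u, n⟫ ≥ t}, ENNReal.ofReal (exp (-a * ‖n‖ ^ 2))
      = ENNReal.ofReal (√(π / a) ^ m) * ∫⁻ r in Set.Ici t, ENNReal.ofReal (exp (-a * r ^ 2)) := by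
  rw [← ofReal_integral_eq_lintegral_ofReal (integrable_exp_neg_mul_sq_norm ha).integrableOn
      (.of_forall fun _ => (exp_pos _).le),
    ← ofReal_integral_eq_lintegral_ofReal (integrable_exp_neg_mul_sq ha).integrableOn
      (.of_forall fun _ => (exp_pos _).le),
    ← ENNReal.ofReal_mul (by positivity), setIntegral_halfSpace_exp_neg_mul_sq_norm hu]

/-- Writing `(1 + q) ^ (-s)` as a Gamma mixture of exponentials reduces the half-space integral
to a one-dimensional one. -/
theorem setLIntegral_halfSpace_rpow {m : ℕ} {γ : ℝ} (hγ : 0 < γ)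
    {u : EuclideanSpace ℝ (Fin (m + 1))} (hu : ‖u‖ = 1) (t : ℝ) :
    ∫⁻ n in {n : EuclideanSpace ℝ (Fin (m + 1)) | ⟪u, n⟫ ≥ t},
        ENNReal.ofReal ((1 / (1 + ‖n‖ ^ 2 / γ ^ 2)) ^ ((m : ℝ) / 2 + 1) *
          Real.Gamma ((m : ℝ) / 2 + 1))
      = ENNReal.ofReal ((√π * γ) ^ m) *
        ∫⁻ r in Set.Ici t, ENNReal.ofReal (1 + (r / γ) ^ 2)⁻¹ := by
  have hs : 0 < (m : ℝ) / 2 + 1 := by positivity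
  have hq (q : ℝ) : 0 < 1 + q ^ 2 / γ ^ 2 := by positivity
  calc
    _ = ∫⁻ n in {n : EuclideanSpace ℝ (Fin (m + 1)) | ⟪u, n⟫ ≥ t},
          ∫⁻ x in Set.Ioi (0 : ℝ), ENNReal.ofReal
            (x ^ ((m : ℝ) / 2 + 1 - 1) * exp (-((1 + ‖n‖ ^ 2 / γ ^ 2) * x))) :=
      lintegral_congr fun n => (lintegral_rpow_mul_exp_neg_mul_Ioi hs (hq ‖n‖)).symm
    _ = ∫⁻ x in Set.Ioi (0 : ℝ), ∫⁻ n in {n : EuclideanSpace ℝ (Fin (m + 1)) | ⟪u, n⟫ ≥ t},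
          ENNReal.ofReal
            (x ^ ((m : ℝ) / 2 + 1 - 1) * exp (-((1 + ‖n‖ ^ 2 / γ ^ 2) * x))) :=
      lintegral_lintegral_swap (by unfold Function.uncurry; fun_prop)
    _ = ∫⁻ x in Set.Ioi (0 : ℝ), ∫⁻ r in Set.Ici t, ENNReal.ofReal ((√π * γ) ^ m) *
          ENNReal.ofReal (x ^ ((1 : ℝ) - 1) * exp (-((1 + r ^ 2 / γ ^ 2) * x))) := by
      refine setLIntegral_congr_fun measurableSet_Ioi fun x (hx : 0 < x) => ?_
      have hsplit (q : ℝ) : exp (-((1 + q ^ 2 / γ ^ 2) * x))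
          = exp (-x) * exp (-(x / γ ^ 2) * q ^ 2) := by
        rw [← exp_add]; ring_nf
      have hsqrt : x ^ ((m : ℝ) / 2) * √(π / (x / γ ^ 2)) ^ m = (√π * γ) ^ m := by
        rw [div_div_eq_mul_div, Real.sqrt_div (by positivity), Real.sqrt_mul pi_pos.le,
          Real.sqrt_sq hγ.le, div_pow, Real.rpow_div_two_eq_sqrt _ hx.le, Real.rpow_natCast,
          mul_div_cancel₀ _ (by positivity)]
      simp only [hsplit, add_sub_cancel_right, sub_self, rpow_zero, one_mul]
      simp only [ENNReal.ofReal_mul (exp_pos _).le,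
        ENNReal.ofReal_mul (Real.rpow_nonneg hx.le _)]
      rw [lintegral_const_mul _ (by fun_prop), lintegral_const_mul _ (by fun_prop),
        lintegral_const_mul _ (by fun_prop), lintegral_const_mul _ (by fun_prop),
        setLIntegral_halfSpace_exp_neg_mul_sq_norm (by positivity) hu, ← hsqrt,
        ENNReal.ofReal_mul (by positivity)]
      ring
    _ = ∫⁻ r in Set.Ici t, ∫⁻ x in Set.Ioi (0 : ℝ), ENNReal.ofReal ((√π * γ) ^ m) *
          ENNReal.ofReal (x ^ ((1 : ℝ) - 1) * exp (-((1 + r ^ 2 / γ ^ 2) * x))) :=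
      lintegral_lintegral_swap (by unfold Function.uncurry; fun_prop)
    _ = _ := by
      rw [← lintegral_const_mul _ (by fun_prop)]
      refine lintegral_congr fun r => ?_
      rw [lintegral_const_mul _ (by fun_prop), lintegral_rpow_mul_exp_neg_mul_Ioi one_pos (hq r),
        rpow_one, Real.Gamma_one, mul_one, one_div, div_pow]

theorem setLIntegral_Ici_inv_one_add_div_sq {γ : ℝ} (hγ : 0 < γ) (t : ℝ) :
    ∫⁻ r in Set.Ici t, ENNReal.ofReal (1 + (r / γ) ^ 2)⁻¹
      = ENNReal.ofReal (γ * (π / 2 - arctan (t / γ))) := by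
  rw [← ofReal_integral_eq_lintegral_ofReal
      (integrable_inv_one_add_sq.comp_div hγ.ne').integrableOn
      (.of_forall fun _ => by simp only [Pi.zero_apply]; positivity),
    integral_Ici_eq_integral_Ioi]
  have h := integral_comp_mul_left_Ioi (fun x : ℝ => (1 + x ^ 2)⁻¹) t (inv_pos.2 hγ)
  rw [integral_Ioi_inv_one_add_sq, inv_inv, smul_eq_mul] at h
  simp only [div_eq_inv_mul _ γ]
  rw [h]

theorem stmt0 (d : ℕ) (hd : 1 ≤ d) (γ : ℝ) (hγ : 0 < γ)
    (u : EuclideanSpace ℝ (Fin d)) (hu : ‖u‖ = 1) (t : ℝ) :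
    ∫ n in {n : EuclideanSpace ℝ (Fin d) | ⟪u, n⟫ ≥ t}, fC d γ n
      = 1 / 2 - (1 / π) * Real.arctan (t / γ) := by
  obtain ⟨m, rfl⟩ := Nat.exists_eq_add_of_le' hd
  have hs : (((m + 1 : ℕ) : ℝ) + 1) / 2 = (m : ℝ) / 2 + 1 := by push_cast; ring
  have hfC (n : EuclideanSpace ℝ (Fin (m + 1))) : fC (m + 1) γ n
      = (π ^ ((m : ℝ) / 2 + 1) * γ ^ (m + 1))⁻¹ *
        ((1 / (1 + ‖n‖ ^ 2 / γ ^ 2)) ^ ((m : ℝ) / 2 + 1) * Real.Gamma ((m : ℝ) / 2 + 1)) := by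
    have hq : 0 ≤ 1 + ‖n‖ ^ 2 / γ ^ 2 := by positivity
    rw [fC, cC, hs, rpow_neg hγ.le, rpow_natCast, rpow_neg hq, one_div, inv_rpow hq]
    ring
  have hpi : π ^ ((m : ℝ) / 2 + 1) = √π ^ m * π := by
    rw [rpow_add pi_pos, rpow_one, Real.rpow_div_two_eq_sqrt _ pi_pos.le, rpow_natCast]
  have harctan : 0 < π / 2 - arctan (t / γ) := sub_pos.2 (arctan_lt_pi_div_two _)
  have hGamma := Real.Gamma_pos_of_pos (show 0 < (m : ℝ) / 2 + 1 by positivity)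
  simp only [hfC]
  rw [integral_const_mul, integral_eq_lintegral_of_nonneg_ae
      (.of_forall fun n => by simp only [Pi.zero_apply]; positivity)
      (Measurable.aestronglyMeasurable (by fun_prop)),
    setLIntegral_halfSpace_rpow hγ hu, setLIntegral_Ici_inv_one_add_div_sq hγ,
    ← ENNReal.ofReal_mul (by positivity), ENNReal.toReal_ofReal (by positivity), hpi]
  field_simp
  ring
end

section
/- For every dimension d ≥ 1 and every scale γ > 0, the isotropic multivariate Cauchy density integrates to one over ℝ^d: ∫_{ℝ^d} c_d · γ^{−d} · (1 + ‖n‖²/γ²)^{−(d+1)/2} dn = 1, where c_d = Γ((d+1)/2)/π^{(d+1)/2}. -/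
open MeasureTheory Real Filter
open scoped RealInnerProductSpace Topology

section

variable {V : Type*} [NormedAddCommGroup V] [InnerProductSpace ℝ V] [FiniteDimensional ℝ V]
  [MeasurableSpace V] [BorelSpace V]

theorem integrable_rexp_neg_mul_sq_norm {b : ℝ} (hb : 0 < b) :
    Integrable fun v : V => rexp (-b * ‖v‖ ^ 2) := by
  have h := GaussianFourier.integral_rexp_neg_mul_sq_norm (V := V) hb
  refine Integrable.of_integral_ne_zero ?_
  rw [h]
  positivity

/-- The integral of a power of `1 + ‖v‖ ^ 2` over a Euclidean space. -/
theorem integral_one_add_sq_norm_rpow_neg {s : ℝ} (hs : (Module.finrank ℝ V : ℝ) / 2 < s) :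
    ∫ v : V, (1 + ‖v‖ ^ 2) ^ (-s) =
      π ^ ((Module.finrank ℝ V : ℝ) / 2) * Gamma (s - (Module.finrank ℝ V : ℝ) / 2) / Gamma s := by
  set m : ℝ := (Module.finrank ℝ V : ℝ) / 2 with hm
  have hs0 : 0 < s := lt_of_le_of_lt (by positivity) hs
  let F : V → ℝ → ℝ := fun v t => t ^ (s - 1) * rexp (-((1 + ‖v‖ ^ 2) * t))
  have hF (v : V) (t : ℝ) :
      F v t = t ^ (s - 1) * rexp (-t) * rexp (-t * ‖v‖ ^ 2) := by
    simp only [F]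
    rw [mul_assoc, ← exp_add]
    ring_nf
  have gauss {t : ℝ} (ht : t ∈ Set.Ioi (0 : ℝ)) :
      ∫ v : V, F v t = π ^ m * (rexp (-t) * t ^ (s - m - 1)) := by
    have ht' : 0 < t := ht
    simp_rw [hF]
    rw [integral_const_mul, GaussianFourier.integral_rexp_neg_mul_sq_norm ht', ← hm,
      div_rpow pi_pos.le ht'.le, show s - m - 1 = (s - 1) - m by ring, rpow_sub ht' (s - 1) m]
    ring
  have hint : Integrable (Function.uncurry F)
      ((volume : Measure V).prod (volume.restrict (Set.Ioi (0 : ℝ)))) := by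
    rw [integrable_prod_iff' (Measurable.aestronglyMeasurable (by
      simp only [F, Function.uncurry_def]; fun_prop))]
    constructor
    · filter_upwards [ae_restrict_mem measurableSet_Ioi] with t ht
      simp only [Function.uncurry_apply_pair, hF]
      exact (integrable_rexp_neg_mul_sq_norm ht).const_mul _
    · have h := (GammaIntegral_convergent (sub_pos.2 hs)).const_mul (π ^ m)
      refine h.congr ?_
      filter_upwards [ae_restrict_mem measurableSet_Ioi] with t ht
      rw [← gauss ht]
      refine integral_congr_ae (.of_forall fun v => ?_)
      have ht' : 0 < t := ht
      exact (norm_of_nonneg (by simp only [F]; positivity)).symm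
  have hswap := integral_integral_swap hint
  rw [setIntegral_congr_fun measurableSet_Ioi fun t ht => gauss ht, integral_const_mul,
    ← Gamma_eq_integral (sub_pos.2 hs)] at hswap
  rw [eq_div_iff (Gamma_pos_of_pos hs0).ne', ← hswap, ← integral_mul_const]
  refine integral_congr_ae (.of_forall fun v => ?_)
  have hv : 0 < 1 + ‖v‖ ^ 2 := by positivity
  simp only [F]
  rw [integral_rpow_mul_exp_neg_mul_Ioi hs0 hv, one_div, inv_rpow hv.le, rpow_neg hv.le]

end

theorem stmt2 (d : ℕ) (hd : 1 ≤ d) (γ : ℝ) (hγ : 0 < γ) :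
    ∫ n : EuclideanSpace ℝ (Fin d), fC d γ n = 1 := by
  have hscale := Measure.integral_comp_inv_smul_of_nonneg
    (volume : Measure (EuclideanSpace ℝ (Fin d)))
    (fun v => (1 + ‖v‖ ^ 2) ^ (-(((d : ℝ) + 1) / 2))) hγ.le
  have hJ := integral_one_add_sq_norm_rpow_neg (V := EuclideanSpace ℝ (Fin d))
    (s := ((d : ℝ) + 1) / 2) (by rw [finrank_euclideanSpace_fin]; linarith)
  have hnorm (v : EuclideanSpace ℝ (Fin d)) : ‖γ⁻¹ • v‖ ^ 2 = ‖v‖ ^ 2 / γ ^ 2 := by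
    rw [norm_smul, norm_inv, norm_of_nonneg hγ.le, mul_pow, inv_pow]
    ring
  simp_rw [hnorm] at hscale
  have hG : 0 < Gamma (((d : ℝ) + 1) / 2) := Gamma_pos_of_pos (by positivity)
  simp_rw [fC, cC]
  rw [integral_const_mul, hscale, hJ, finrank_euclideanSpace_fin,
    show ((d : ℝ) + 1) / 2 - (d : ℝ) / 2 = 1 / 2 by ring, Gamma_one_half_eq, sqrt_eq_rpow,
    ← rpow_add pi_pos, ← add_div, rpow_neg hγ.le, rpow_natCast, smul_eq_mul]
  field_simp
end

section
/- Let C = {x_1, …, x_M} ⊂ ℝ^d be a finite set of M distinct points, with d_ij = ‖x_i − x_j‖ for i ≠ j. Then there exist constants K > 0 and γ₀ > 0 such that for all 0 < γ < γ₀, the average symbol error probability under equiprobable signaling satisfies (1/M)·Σ_{i=1}^M P_e(x_i;γ) ≤ (4γ/(Mπ))·Σ_{1 ≤ i < j ≤ M} 1/d_ij + K·γ³. -/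
open MeasureTheory Real Filter
open scoped RealInnerProductSpace Topology

/-- The Voronoi cell of `x` in the constellation `C`. -/
def vor {d : ℕ} (C : Set (EuclideanSpace ℝ (Fin d))) (x : EuclideanSpace ℝ (Fin d)) :
    Set (EuclideanSpace ℝ (Fin d)) := {y | ∀ c ∈ C, ‖y - x‖ ≤ ‖y - c‖}

/-- The Voronoi cell of `x` translated by `-x`. -/
def vorT {d : ℕ} (C : Set (EuclideanSpace ℝ (Fin d))) (x : EuclideanSpace ℝ (Fin d)) :
    Set (EuclideanSpace ℝ (Fin d)) := (fun y => y - x) '' vor C x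

/-- Conditional symbol error probability `P_e(x;γ)`. -/
noncomputable def Pe {d : ℕ} (C : Set (EuclideanSpace ℝ (Fin d)))
    (x : EuclideanSpace ℝ (Fin d)) (γ : ℝ) : ℝ :=
  ∫ n in (vorT C x)ᶜ, fC d γ n

theorem lintegral_fin_prod_eq_prod {n : ℕ} (f : Fin n → ℝ → ENNReal)
    (hf : ∀ i, Measurable (f i)) :
    ∫⁻ x : Fin n → ℝ, ∏ i, f i (x i) = ∏ i, ∫⁻ r, f i r := by
  induction n with
  | zero => simp [volume_pi]
  | succ n ih =>
    rw [← (volume_preserving_piFinSuccAbove (fun _ => ℝ) 0).symm.lintegral_comp_emb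
      (MeasurableEquiv.measurableEmbedding _), Fin.prod_univ_succ, ← ih _ fun i => hf i.succ,
      ← lintegral_prod_mul (hf 0).aemeasurable (Finset.measurable_prod _ fun i _ =>
        (hf i.succ).comp (measurable_pi_apply i)).aemeasurable]
    simp [Fin.prod_univ_succ, MeasurableEquiv.piFinSuccAbove_symm_apply, Fin.insertNthEquiv,
      Measure.volume_eq_prod]

theorem lintegral_gaussian {s : ℝ} (hs : 0 < s) :
    ∫⁻ r : ℝ, ENNReal.ofReal (exp (-s * r ^ 2)) = ENNReal.ofReal √(π / s) := by
  rw [← integral_gaussian, ofReal_integral_eq_lintegral_ofReal (integrable_exp_neg_mul_sq hs)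
    (ae_of_all _ fun _ => (exp_pos _).le)]

theorem setLIntegral_gamma_kernel {a r : ℝ} (ha : 0 < a) (hr : 0 < r) :
    ∫⁻ s in Set.Ioi (0 : ℝ), ENNReal.ofReal (s ^ (a - 1) * exp (-(r * s)))
      = ENNReal.ofReal ((1 / r) ^ a * Gamma a) := by
  have h := integral_rpow_mul_exp_neg_mul_Ioi ha hr
  rw [← h, ofReal_integral_eq_lintegral_ofReal]
  · refine .of_integral_ne_zero ?_
    rw [h]
    have := Gamma_pos_of_pos ha
    positivity
  · filter_upwards [ae_restrict_mem measurableSet_Ioi] with s hs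
    have : 0 < s := hs
    simp only [Pi.zero_apply]
    positivity

theorem setLIntegral_gaussian_halfspace {m : ℕ} {u : EuclideanSpace ℝ (Fin (m + 1))}
    (hu : ‖u‖ = 1) (t : ℝ) {s : ℝ} (hs : 0 < s) :
    ∫⁻ n in {n | t < ⟪u, n⟫}, ENNReal.ofReal (exp (-s * ‖n‖ ^ 2))
      = (∫⁻ r in Set.Ioi t, ENNReal.ofReal (exp (-s * r ^ 2)))
        * ENNReal.ofReal √(π / s) ^ m := by
  obtain ⟨b, hb⟩ := Orthonormal.exists_orthonormalBasis_extension_of_card_eq (𝕜 := ℝ)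
    (ι := Fin (m + 1)) (E := EuclideanSpace ℝ (Fin (m + 1))) (by simp) (v := fun _ => u)
    (s := {0}) (by
      refine ⟨fun i => by simpa [Set.domRestrict] using hu, fun i j hij => ?_⟩
      exact absurd (Subsingleton.elim i j) hij)
  have hb0 : b 0 = u := hb 0 rfl
  have hH : MeasurableSet {n : EuclideanSpace ℝ (Fin (m + 1)) | t < ⟪u, n⟫} :=
    measurableSet_lt measurable_const (by fun_prop)
  let g : Fin (m + 1) → ℝ → ENNReal := fun i r =>
    Fin.cases (motive := fun _ => ENNReal) (Set.indicator (Set.Ioi t)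
      (fun r => ENNReal.ofReal (exp (-s * r ^ 2))) r) (fun _ => ENNReal.ofReal (exp (-s * r ^ 2))) i
  have hg : ∀ i, Measurable (g i) := by
    intro i
    refine Fin.cases ?_ (fun j => ?_) i
    · exact Measurable.indicator (by fun_prop) measurableSet_Ioi
    · change Measurable fun r => ENNReal.ofReal (exp (-s * r ^ 2))
      fun_prop
  have key := lintegral_fin_prod_eq_prod g hg
  rw [Fin.prod_univ_succ] at key
  have h0 : ∫⁻ r, g 0 r = ∫⁻ r in Set.Ioi t, ENNReal.ofReal (exp (-s * r ^ 2)) :=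
    lintegral_indicator measurableSet_Ioi _
  have h1 : ∀ i : Fin m, ∫⁻ r, g i.succ r = ENNReal.ofReal √(π / s) :=
    fun i => lintegral_gaussian hs
  simp only [h0, h1, Finset.prod_const, Finset.card_univ, Fintype.card_fin] at key
  rw [← key, ← lintegral_indicator hH,
    ← (b.measurePreserving_repr_symm.comp
      (PiLp.volume_preserving_toLp (Fin (m + 1)))).lintegral_comp_emb
      (b.measurableEquiv.symm.measurableEmbedding.comp
        (MeasurableEquiv.toLp 2 (Fin (m + 1) → ℝ)).measurableEmbedding)]
  refine lintegral_congr fun y => ?_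
  have hin : ⟪u, b.repr.symm (WithLp.toLp 2 y)⟫ = y 0 := by
    rw [← hb0, ← b.repr_apply_apply]; simp
  have hn : ‖b.repr.symm (WithLp.toLp 2 y)‖ ^ 2 = ∑ i, y i ^ 2 := by
    rw [LinearIsometryEquiv.norm_map, EuclideanSpace.norm_sq_eq]; simp
  have hprod : ENNReal.ofReal (exp (-s * ∑ i, y i ^ 2))
      = ∏ i, ENNReal.ofReal (exp (-s * y i ^ 2)) := by
    rw [← ENNReal.ofReal_prod_of_nonneg fun _ _ => (exp_pos _).le, ← exp_sum, Finset.mul_sum]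
  rw [Fin.prod_univ_succ]
  simp only [Function.comp_apply, Set.indicator_apply, Set.mem_ofPred_eq, hin, hn, hprod]
  rw [Fin.prod_univ_succ]
  by_cases h : t < y 0 <;> simp [g, h]

theorem setLIntegral_inv_sq_Ioi {t : ℝ} (ht : 0 < t) :
    ∫⁻ r in Set.Ioi t, ENNReal.ofReal (1 / r ^ 2) = ENNReal.ofReal (1 / t) := by
  have h := integral_Ioi_rpow_of_lt (a := -2) (by norm_num) ht
  have hi := integrableOn_Ioi_rpow_of_lt (a := -2) (by norm_num) ht
  have e : -t ^ ((-2 : ℝ) + 1) / (-2 + 1) = 1 / t := by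
    norm_num [rpow_neg_one]
  rw [e] at h
  rw [← h, ofReal_integral_eq_lintegral_ofReal hi]
  · refine setLIntegral_congr_fun measurableSet_Ioi fun r hr => ?_
    have : 0 < r := ht.trans hr
    rw [rpow_neg this.le]
    norm_num
  · filter_upwards [ae_restrict_mem measurableSet_Ioi] with r hr
    have : 0 < r := ht.trans hr
    simp only [Pi.zero_apply]
    positivity

theorem setLIntegral_norm_rpow_halfspace {m : ℕ} {u : EuclideanSpace ℝ (Fin (m + 1))}
    (hu : ‖u‖ = 1) {t : ℝ} (ht : 0 < t) :
    ∫⁻ n in {n | t < ⟪u, n⟫}, ENNReal.ofReal ((1 / ‖n‖ ^ 2) ^ ((m : ℝ) / 2 + 1)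
        * Gamma ((m : ℝ) / 2 + 1)) = ENNReal.ofReal (π ^ ((m : ℝ) / 2) / t) := by
  have hH : MeasurableSet {n : EuclideanSpace ℝ (Fin (m + 1)) | t < ⟪u, n⟫} :=
    measurableSet_lt measurable_const (by fun_prop)
  calc
    _ = ∫⁻ n in {n | t < ⟪u, n⟫}, ∫⁻ s in Set.Ioi (0 : ℝ),
          ENNReal.ofReal (s ^ ((m : ℝ) / 2) * exp (-(‖n‖ ^ 2 * s))) := by
      refine setLIntegral_congr_fun hH fun n hn => ?_
      have hn0 : n ≠ 0 := by
        rintro rfl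
        simp only [Set.mem_ofPred_eq, inner_zero_right] at hn
        exact lt_asymm ht hn
      have := setLIntegral_gamma_kernel (a := (m : ℝ) / 2 + 1) (r := ‖n‖ ^ 2) (by positivity)
        (by positivity)
      simp only [add_sub_cancel_right] at this
      exact this.symm
    _ = ∫⁻ s in Set.Ioi (0 : ℝ), ∫⁻ n in {n | t < ⟪u, n⟫},
          ENNReal.ofReal (s ^ ((m : ℝ) / 2) * exp (-(‖n‖ ^ 2 * s))) :=
      lintegral_lintegral_swap (by fun_prop)
    _ = ∫⁻ s in Set.Ioi (0 : ℝ), ∫⁻ r in Set.Ioi t,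
          ENNReal.ofReal (π ^ ((m : ℝ) / 2) * exp (-(r ^ 2 * s))) := by
      refine setLIntegral_congr_fun measurableSet_Ioi fun s hs => ?_
      have hs : 0 < s := hs
      have h := setLIntegral_gaussian_halfspace hu t hs
      have e : ∀ x : ℝ, -(x * s) = -s * x := fun x => by ring
      have hp : √(π / s) ^ m = π ^ ((m : ℝ) / 2) / s ^ ((m : ℝ) / 2) := by
        rw [← div_rpow pi_pos.le hs.le, sqrt_eq_rpow, ← rpow_natCast, ← rpow_mul (by positivity)]
        congr 1; ring
      simp only [e]
      simp_rw [ENNReal.ofReal_mul (rpow_nonneg hs.le ((m : ℝ) / 2)),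
        ENNReal.ofReal_mul (rpow_nonneg pi_pos.le ((m : ℝ) / 2))]
      rw [lintegral_const_mul _ (by fun_prop), lintegral_const_mul _ (by fun_prop), h,
        ← ENNReal.ofReal_pow (sqrt_nonneg _), hp, mul_left_comm,
        ← ENNReal.ofReal_mul (by positivity), mul_div_cancel₀ _ (by positivity), mul_comm]
    _ = ∫⁻ r in Set.Ioi t, ∫⁻ s in Set.Ioi (0 : ℝ),
          ENNReal.ofReal (π ^ ((m : ℝ) / 2) * exp (-(r ^ 2 * s))) :=
      lintegral_lintegral_swap (by fun_prop)
    _ = ∫⁻ r in Set.Ioi t, ENNReal.ofReal (π ^ ((m : ℝ) / 2)) * ENNReal.ofReal (1 / r ^ 2) := by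
      refine setLIntegral_congr_fun measurableSet_Ioi fun r hr => ?_
      have hr : 0 < r := ht.trans hr
      have := setLIntegral_gamma_kernel (a := 1) (r := r ^ 2) one_pos (by positivity)
      simp only [sub_self, rpow_zero, one_mul, rpow_one, Gamma_one, mul_one] at this
      simp_rw [ENNReal.ofReal_mul (rpow_nonneg pi_pos.le ((m : ℝ) / 2))]
      rw [lintegral_const_mul _ (by fun_prop), this]
    _ = _ := by
      rw [lintegral_const_mul _ (by fun_prop), setLIntegral_inv_sq_Ioi ht,
        ← ENNReal.ofReal_mul (by positivity), mul_one_div]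

theorem cC_succ_mul {m : ℕ} :
    cC (m + 1) * π ^ ((m : ℝ) / 2) = Gamma ((m : ℝ) / 2 + 1) / π := by
  have e : (((m + 1 : ℕ) : ℝ) + 1) / 2 = (m : ℝ) / 2 + 1 := by push_cast; ring
  have := rpow_pos_of_pos pi_pos ((m : ℝ) / 2)
  rw [cC, e, rpow_add_one pi_ne_zero]
  field_simp

theorem fC_le {m : ℕ} {γ : ℝ} (hγ : 0 < γ) {n : EuclideanSpace ℝ (Fin (m + 1))} (hn : n ≠ 0) :
    fC (m + 1) γ n ≤ cC (m + 1) * γ * (1 / ‖n‖ ^ 2) ^ ((m : ℝ) / 2 + 1) := by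
  have e : (((m + 1 : ℕ) : ℝ) + 1) / 2 = (m : ℝ) / 2 + 1 := by push_cast; ring
  have hn' : 0 < ‖n‖ := norm_pos_iff.2 hn
  have hc : 0 ≤ cC (m + 1) := by
    have := Gamma_pos_of_pos (s := (((m + 1 : ℕ) : ℝ) + 1) / 2) (by positivity)
    rw [cC]; positivity
  have h1 : (1 + ‖n‖ ^ 2 / γ ^ 2) ^ (-((m : ℝ) / 2 + 1))
      ≤ (‖n‖ ^ 2 / γ ^ 2) ^ (-((m : ℝ) / 2 + 1)) :=
    rpow_le_rpow_of_nonpos (by positivity) (by linarith) (by linarith [m.cast_nonneg (α := ℝ)])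
  have h2 : γ ^ (-((m + 1 : ℕ) : ℝ)) * (‖n‖ ^ 2 / γ ^ 2) ^ (-((m : ℝ) / 2 + 1))
      = γ * (1 / ‖n‖ ^ 2) ^ ((m : ℝ) / 2 + 1) := by
    rw [rpow_neg (x := ‖n‖ ^ 2 / γ ^ 2) (by positivity), ← inv_rpow (by positivity), inv_div, div_eq_mul_one_div,
      mul_rpow (by positivity) (by positivity), ← mul_assoc, ← rpow_natCast γ 2,
      ← rpow_mul hγ.le, ← rpow_add hγ]
    congr 1
    conv_rhs => rw [← rpow_one γ]
    congr 1
    push_cast; ring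
  rw [fC, e, mul_assoc, mul_assoc, ← h2]
  gcongr

theorem setLIntegral_fC_halfspace_le {m : ℕ} {u : EuclideanSpace ℝ (Fin (m + 1))}
    (hu : ‖u‖ = 1) {t γ : ℝ} (ht : 0 < t) (hγ : 0 < γ) :
    ∫⁻ n in {n | t < ⟪u, n⟫}, ENNReal.ofReal (fC (m + 1) γ n)
      ≤ ENNReal.ofReal (γ / (π * t)) := by
  have hH : MeasurableSet {n : EuclideanSpace ℝ (Fin (m + 1)) | t < ⟪u, n⟫} :=
    measurableSet_lt measurable_const (by fun_prop)
  have hG : 0 < Gamma ((m : ℝ) / 2 + 1) := Gamma_pos_of_pos (by positivity)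
  have hp := rpow_pos_of_pos pi_pos ((m : ℝ) / 2)
  have hc : cC (m + 1) = Gamma ((m : ℝ) / 2 + 1) / π / π ^ ((m : ℝ) / 2) :=
    eq_div_of_mul_eq hp.ne' cC_succ_mul
  calc
    _ ≤ ∫⁻ n in {n | t < ⟪u, n⟫}, ENNReal.ofReal (γ / (π * π ^ ((m : ℝ) / 2))) *
          ENNReal.ofReal ((1 / ‖n‖ ^ 2) ^ ((m : ℝ) / 2 + 1) * Gamma ((m : ℝ) / 2 + 1)) := by
      refine setLIntegral_mono' hH fun n hn => ?_
      have hn0 : n ≠ 0 := by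
        rintro rfl
        simp only [Set.mem_ofPred_eq, inner_zero_right] at hn
        exact lt_asymm ht hn
      rw [← ENNReal.ofReal_mul (by positivity)]
      refine ENNReal.ofReal_le_ofReal ((fC_le hγ hn0).trans_eq ?_)
      rw [hc]
      field_simp
    _ = _ := by
      rw [lintegral_const_mul _ (by fun_prop), setLIntegral_norm_rpow_halfspace hu ht,
        ← ENNReal.ofReal_mul (by positivity)]
      congr 1
      field_simp

theorem vorT_range_compl_subset {d M : ℕ} (x : Fin M → EuclideanSpace ℝ (Fin d)) (i : Fin M) :
    (vorT (Set.range x) (x i))ᶜ ⊆ ⋃ j ∈ Finset.univ.filter (fun j => x j ≠ x i),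
      {n | ‖x i - x j‖ / 2 < ⟪(‖x i - x j‖)⁻¹ • (x j - x i), n⟫} := by
  intro n hn
  have h : n + x i ∉ vor (Set.range x) (x i) := fun h => hn ⟨_, h, by simp⟩
  simp only [vor, Set.mem_ofPred_eq, Set.forall_mem_range, not_forall, not_le,
    add_sub_cancel_right] at h
  obtain ⟨j, hj⟩ := h
  have hne : x j ≠ x i := fun e => by simp [e] at hj
  have hpos : 0 < ‖x i - x j‖ := norm_pos_iff.2 (sub_ne_zero.2 hne.symm)
  simp only [Set.mem_iUnion, Finset.mem_filter, Finset.mem_univ, true_and]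
  refine ⟨j, hne, ?_⟩
  have e : n + x i - x j = n - (x j - x i) := by abel
  have h2 : ‖n - (x j - x i)‖ ^ 2 < ‖n‖ ^ 2 := by
    rw [← e]; gcongr
  rw [norm_sub_sq_real, norm_sub_rev (x j), real_inner_comm] at h2
  rw [Set.mem_ofPred_eq, real_inner_smul_left, ← div_eq_inv_mul, lt_div_iff₀ hpos]
  nlinarith

theorem Pe_range_le {d M : ℕ} (hd : 1 ≤ d) (x : Fin M → EuclideanSpace ℝ (Fin d)) (i : Fin M)
    {γ : ℝ} (hγ : 0 < γ) :
    Pe (Set.range x) (x i) γ ≤ ∑ j, 2 * γ / π * (1 / ‖x i - x j‖) := by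
  obtain ⟨m, rfl⟩ := Nat.exists_eq_add_of_le' hd
  set S := Finset.univ.filter (fun j => x j ≠ x i)
  have hnn : ∀ j, 0 ≤ 2 * γ / π * (1 / ‖x i - x j‖) := fun j => by positivity
  have hf : ∀ n, 0 ≤ fC (m + 1) γ n := fun n => by
    have := Gamma_pos_of_pos (s := (((m + 1 : ℕ) : ℝ) + 1) / 2) (by positivity)
    rw [fC, cC]; positivity
  have hmeas : Measurable (fC (m + 1) γ) := by unfold fC; fun_prop
  rw [Pe, integral_eq_lintegral_of_nonneg_ae (ae_of_all _ hf) hmeas.aestronglyMeasurable]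
  refine ENNReal.toReal_le_of_le_ofReal (Finset.sum_nonneg fun j _ => hnn j) ?_
  calc
    _ ≤ ∫⁻ n in ⋃ j : S, {n | ‖x i - x j‖ / 2 < ⟪(‖x i - x j‖)⁻¹ • (x j - x i), n⟫},
          ENNReal.ofReal (fC (m + 1) γ n) := by
      refine lintegral_mono_set ((vorT_range_compl_subset x i).trans ?_)
      rw [Set.iUnion_subtype]
    _ ≤ ∑' j : S, ∫⁻ n in {n | ‖x i - x j‖ / 2 < ⟪(‖x i - x j‖)⁻¹ • (x j - x i), n⟫},
          ENNReal.ofReal (fC (m + 1) γ n) := lintegral_iUnion_le _ _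
    _ ≤ ∑' j : S, ENNReal.ofReal (2 * γ / π * (1 / ‖x i - x j‖)) := by
      refine ENNReal.tsum_le_tsum fun j => ?_
      have hne : x j ≠ x i := (Finset.mem_filter.1 j.2).2
      have hpos : 0 < ‖x i - x j‖ := norm_pos_iff.2 (sub_ne_zero.2 hne.symm)
      refine (setLIntegral_fC_halfspace_le ?_ (half_pos hpos) hγ).trans_eq ?_
      · rw [norm_smul, norm_sub_rev (x j), norm_inv, norm_norm, inv_mul_cancel₀ hpos.ne']
      · congr 1
        field_simp
    _ ≤ _ := by
      rw [Finset.tsum_subtype S fun j => ENNReal.ofReal (2 * γ / π * (1 / ‖x i - x j‖)),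
        ← ENNReal.ofReal_sum_of_nonneg fun j _ => hnn j]
      exact ENNReal.ofReal_le_ofReal
        (Finset.sum_le_sum_of_subset_of_nonneg (Finset.subset_univ _) fun j _ _ => hnn j)

theorem sum_sum_eq_two_mul_sum_lt {M : ℕ} (a : Fin M → Fin M → ℝ) (hsymm : ∀ i j, a i j = a j i)
    (hdiag : ∀ i, a i i = 0) :
    ∑ i, ∑ j, a i j = 2 * ∑ i, ∑ j ∈ Finset.univ.filter (fun j => i < j), a i j := by
  have h : ∀ i j, a i j = (if i < j then a i j else 0) + if j < i then a j i else 0 := by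
    intro i j
    rcases lt_trichotomy i j with h | rfl | h
    · simp [h, h.asymm]
    · simp [hdiag]
    · simp [h, h.asymm, hsymm i j]
  simp_rw [Finset.sum_filter]
  rw [Finset.sum_congr rfl fun i _ => Finset.sum_congr rfl fun j _ => h i j]
  simp_rw [Finset.sum_add_distrib]
  rw [Finset.sum_comm (f := fun i j => if j < i then a j i else 0), two_mul]

theorem stmt6 (d M : ℕ) (hd : 1 ≤ d) (hM : 1 ≤ M)
    (x : Fin M → EuclideanSpace ℝ (Fin d)) (hx : Function.Injective x) :
    ∃ K > (0 : ℝ), ∃ γ₀ > (0 : ℝ), ∀ γ : ℝ, 0 < γ → γ < γ₀ →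
      (1 / (M : ℝ)) * ∑ i : Fin M, Pe (Set.range x) (x i) γ
        ≤ (4 * γ / ((M : ℝ) * π)) *
            (∑ i : Fin M, ∑ j ∈ Finset.univ.filter (fun j : Fin M => i < j),
              1 / ‖x i - x j‖) + K * γ ^ 3 := by
  refine ⟨1, one_pos, 1, one_pos, fun γ hγ _ => ?_⟩
  have h := Finset.sum_le_sum fun i (_ : i ∈ Finset.univ) => Pe_range_le hd x i hγ
  simp_rw [← Finset.mul_sum] at h
  rw [sum_sum_eq_two_mul_sum_lt _ (fun i j => by rw [norm_sub_rev]) (by simp)] at h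
  set T := ∑ i : Fin M, ∑ j ∈ Finset.univ.filter (fun j : Fin M => i < j), 1 / ‖x i - x j‖
  have hM' : (0 : ℝ) < M := by exact_mod_cast hM
  calc
    _ ≤ 1 / (M : ℝ) * (2 * γ / π * (2 * T)) := by gcongr
    _ = 4 * γ / ((M : ℝ) * π) * T := by field_simp; ring
    _ ≤ _ := le_add_of_nonneg_right (by positivity)
end

section
/- Let C ⊂ ℝ^d be a finite set and let x ∈ C. Suppose u ∈ ℝ^d satisfies ⟪u, c − x⟫ ≠ 0 for every c ∈ C with c ≠ x. Then: (i) if u ∈ K(x), there exists γ₁ > 0 such that γ·u ∈ V(x) − x for all γ ≥ γ₁; and (ii) if u ∉ K(x), there exists γ₁ > 0 such that γ·u ∉ V(x) − x for all γ ≥ γ₁. Consequently, the indicator of the rescaled cell (V(x) − x)/γ converges pointwise to the indicator of the recession cone K(x) at every such u. -/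
open MeasureTheory Real Filter
open scoped RealInnerProductSpace Topology

/-- The recession cone of the Voronoi cell of `x`. -/
def recCone {d : ℕ} (C : Set (EuclideanSpace ℝ (Fin d))) (x : EuclideanSpace ℝ (Fin d)) :
    Set (EuclideanSpace ℝ (Fin d)) := {u | ∀ c ∈ C, ⟪u, c - x⟫ ≤ 0}

theorem mem_vorT_iff {d : ℕ} {C : Set (EuclideanSpace ℝ (Fin d))} {x w : EuclideanSpace ℝ (Fin d)} :
    w ∈ vorT C x ↔ ∀ c ∈ C, 2 * ⟪w, c - x⟫ ≤ ‖c - x‖ ^ 2 := by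
  have key (c : EuclideanSpace ℝ (Fin d)) :
      ‖w‖ ≤ ‖w - (c - x)‖ ↔ 2 * ⟪w, c - x⟫ ≤ ‖c - x‖ ^ 2 := by
    rw [← sq_le_sq₀ (norm_nonneg _) (norm_nonneg _), norm_sub_sq_real]
    constructor <;> intro h <;> linarith
  have hvor : w ∈ vorT C x ↔ w + x ∈ vor C x := by
    simp [vorT, sub_eq_iff_eq_add]
  rw [hvor]
  refine forall₂_congr fun c _ => ?_
  rw [← key, add_sub_cancel_right, sub_sub_eq_add_sub]

theorem smul_mem_vorT {d : ℕ} {C : Set (EuclideanSpace ℝ (Fin d))}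
    {x u : EuclideanSpace ℝ (Fin d)} (hu : u ∈ recCone C x) {γ : ℝ} (hγ : 0 ≤ γ) :
    γ • u ∈ vorT C x := by
  refine mem_vorT_iff.2 fun c hc => ?_
  rw [real_inner_smul_left]
  nlinarith [mul_nonpos_of_nonneg_of_nonpos hγ (hu c hc), sq_nonneg ‖c - x‖]

theorem exists_forall_smul_notMem_vorT {d : ℕ} {C : Set (EuclideanSpace ℝ (Fin d))}
    {x u : EuclideanSpace ℝ (Fin d)} (hu : u ∉ recCone C x) :
    ∃ γ₁ > (0 : ℝ), ∀ γ : ℝ, γ₁ ≤ γ → γ • u ∉ vorT C x := by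
  obtain ⟨c, hc, hpos⟩ : ∃ c ∈ C, 0 < ⟪u, c - x⟫ := by
    simpa [recCone] using hu
  refine ⟨‖c - x‖ ^ 2 / ⟪u, c - x⟫ + 1, by positivity, fun γ hγ hmem => ?_⟩
  have hle := mem_vorT_iff.1 hmem c hc
  rw [real_inner_smul_left] at hle
  have hlt : ‖c - x‖ ^ 2 < γ * ⟪u, c - x⟫ := (div_lt_iff₀ hpos).1 (by linarith)
  linarith [sq_nonneg ‖c - x‖]

theorem stmt9 (d : ℕ) (C : Set (EuclideanSpace ℝ (Fin d))) (hC : C.Finite)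
    (x : EuclideanSpace ℝ (Fin d)) (hx : x ∈ C)
    (u : EuclideanSpace ℝ (Fin d))
    (hu : ∀ c ∈ C, c ≠ x → ⟪u, c - x⟫ ≠ 0) :
    ((u ∈ recCone C x → ∃ γ₁ > (0 : ℝ), ∀ γ : ℝ, γ₁ ≤ γ → γ • u ∈ vorT C x) ∧
     (u ∉ recCone C x → ∃ γ₁ > (0 : ℝ), ∀ γ : ℝ, γ₁ ≤ γ → γ • u ∉ vorT C x)) ∧
    Tendsto (fun γ : ℝ => Set.indicator {w | γ • w ∈ vorT C x} (fun _ => (1 : ℝ)) u)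
      atTop (nhds (Set.indicator (recCone C x) (fun _ => (1 : ℝ)) u)) := by
  have hin : u ∈ recCone C x → ∃ γ₁ > (0 : ℝ), ∀ γ : ℝ, γ₁ ≤ γ → γ • u ∈ vorT C x :=
    fun h => ⟨1, one_pos, fun γ hγ => smul_mem_vorT h (zero_le_one.trans hγ)⟩
  refine ⟨⟨hin, exists_forall_smul_notMem_vorT⟩, tendsto_const_nhds.congr' ?_⟩
  by_cases h : u ∈ recCone C x
  · obtain ⟨γ₁, -, hγ₁⟩ := hin h
    filter_upwards [eventually_ge_atTop γ₁] with γ hγ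
    simp [Set.indicator, h, hγ₁ γ hγ]
  · obtain ⟨γ₁, -, hγ₁⟩ := exists_forall_smul_notMem_vorT h
    filter_upwards [eventually_ge_atTop γ₁] with γ hγ
    simp [Set.indicator, h, hγ₁ γ hγ]
end

section
/- Let α ≤ β be real numbers with β − α ≤ 2π, and let S = { (r·cos θ, r·sin θ) ∈ ℝ² : r > 0, α ≤ θ ≤ β } be the open planar sector with angular aperture [α, β]. Then the two-dimensional isotropic Cauchy mass of the sector equals its normalized angle: ∫_S (1/(2π)) · (1 + ‖u‖²)^{−3/2} du = (β − α)/(2π). -/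
open MeasureTheory Real

/-- The set of polar angles of the points in the sector with angular aperture `[α, β]`. -/
def sectorAngles (α β : ℝ) : Set ℝ :=
  {θ | ∃ θ' : ℝ, α ≤ θ' ∧ θ' ≤ β ∧ cos θ = cos θ' ∧ sin θ = sin θ'}

/-- The open planar sector with angular aperture `[α, β]`, as a subset of `ℝ × ℝ`. -/
def planarSector (α β : ℝ) : Set (ℝ × ℝ) :=
  {p | ∃ r θ : ℝ, 0 < r ∧ α ≤ θ ∧ θ ≤ β ∧ p.1 = r * cos θ ∧ p.2 = r * sin θ}

theorem sqrt_sq_polar {r : ℝ} (hr : 0 < r) (θ : ℝ) :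
    √((r * cos θ) ^ 2 + (r * sin θ) ^ 2) = r := by
  rw [← Real.sqrt_sq hr.le]
  congr 1
  rw [Real.sqrt_sq hr.le]
  linear_combination r ^ 2 * Real.cos_sq_add_sin_sq θ

theorem measurableSet_planarSector (α β : ℝ) : MeasurableSet (planarSector α β) := by
  let ρ : ℝ × ℝ → ℝ := fun p => √(p.1 ^ 2 + p.2 ^ 2)
  have hρ : Measurable ρ := by fun_prop
  have hK : IsClosed ((fun θ : ℝ => (cos θ, sin θ)) '' Set.Icc α β) :=
    (isCompact_Icc.image (by fun_prop)).isClosed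
  have h : planarSector α β = {p | 0 < ρ p} ∩
      (fun p => (p.1 / ρ p, p.2 / ρ p)) ⁻¹' ((fun θ : ℝ => (cos θ, sin θ)) '' Set.Icc α β) := by
    ext ⟨x, y⟩
    constructor
    · rintro ⟨r, θ, hr, h1, h2, rfl : x = _, rfl : y = _⟩
      have hr' : ρ (r * cos θ, r * sin θ) = r := sqrt_sq_polar hr θ
      refine ⟨by simpa only [Set.mem_ofPred_eq, hr'] using hr, θ, ⟨h1, h2⟩, ?_⟩
      simp only [hr', mul_div_cancel_left₀ _ hr.ne']
    · rintro ⟨hr : 0 < ρ (x, y), θ, ⟨h1, h2⟩, h⟩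
      simp only [Prod.mk.injEq] at h
      refine ⟨ρ (x, y), θ, hr, h1, h2, ?_, ?_⟩
      · rw [h.1, mul_div_cancel₀ _ hr.ne']
      · rw [h.2, mul_div_cancel₀ _ hr.ne']
  rw [h]
  exact (measurableSet_lt measurable_const hρ).inter
    (((measurable_fst.div hρ).prodMk (measurable_snd.div hρ)) hK.measurableSet)

theorem polar_mem_planarSector_iff {α β r : ℝ} (hr : 0 < r) (θ : ℝ) :
    (r * cos θ, r * sin θ) ∈ planarSector α β ↔ θ ∈ sectorAngles α β := by
  constructor
  · rintro ⟨r', θ', hr', h1, h2, hc, hs⟩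
    simp only at hc hs
    have : r = r' := by
      rw [← sqrt_sq_polar hr θ, hc, hs, sqrt_sq_polar hr' θ']
    subst this
    exact ⟨θ', h1, h2, mul_left_cancel₀ hr.ne' hc, mul_left_cancel₀ hr.ne' hs⟩
  · rintro ⟨θ', h1, h2, hc, hs⟩
    exact ⟨r, θ', hr, h1, h2, by simp only [hc], by simp only [hs]⟩

theorem mem_sectorAngles_iff {α β θ : ℝ} (h2π : β - α ≤ 2 * π)
    (hθ : θ ∈ Set.Ioo α (α + 2 * π)) : θ ∈ sectorAngles α β ↔ θ ≤ β := by
  constructor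
  · rintro ⟨θ', h1, h2, hc, hs⟩
    obtain ⟨k, hk⟩ := Real.Angle.angle_eq_iff_two_pi_dvd_sub.1 (Real.Angle.cos_sin_inj hc hs)
    obtain ⟨hθ1, hθ2⟩ := hθ
    have hk0 : k ≤ 0 := by
      by_contra! hk1
      have : (1 : ℝ) ≤ k := by exact_mod_cast hk1
      nlinarith [Real.pi_pos]
    have : (k : ℝ) ≤ 0 := by exact_mod_cast hk0
    nlinarith [Real.pi_pos]
  · exact fun h => ⟨θ, hθ.1.le, h, rfl, rfl⟩

theorem integral_indicator_sectorAngles {α β : ℝ} (hαβ : α ≤ β) (h2π : β - α ≤ 2 * π) :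
    ∫ θ in Set.Ioo (-π) π, (sectorAngles α β).indicator (fun _ => (1 : ℝ)) θ = β - α := by
  have hper : Function.Periodic ((sectorAngles α β).indicator (fun _ => (1 : ℝ))) (2 * π) := by
    intro θ
    have : θ + 2 * π ∈ sectorAngles α β ↔ θ ∈ sectorAngles α β := by
      simp [sectorAngles]
    by_cases h : θ ∈ sectorAngles α β
    · rw [Set.indicator_of_mem h, Set.indicator_of_mem (this.2 h)]
    · rw [Set.indicator_of_notMem h, Set.indicator_of_notMem (mt this.1 h)]
  have hshift := hper.intervalIntegral_add_eq (-π) α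
  rw [show -π + 2 * π = π by ring, intervalIntegral.integral_of_le (by linarith [Real.pi_pos]),
    intervalIntegral.integral_of_le (by linarith [Real.pi_pos]), integral_Ioc_eq_integral_Ioo,
    integral_Ioc_eq_integral_Ioo] at hshift
  rw [hshift]
  have hcongr : Set.EqOn ((sectorAngles α β).indicator (fun _ => (1 : ℝ)))
      ((Set.Iic β).indicator (fun _ => (1 : ℝ))) (Set.Ioo α (α + 2 * π)) := by
    intro θ hθ
    classical
    simp only [Set.indicator_apply, mem_sectorAngles_iff h2π hθ, Set.mem_Iic]
  rw [setIntegral_congr_fun measurableSet_Ioo hcongr, ← integral_Ioc_eq_integral_Ioo,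
    setIntegral_indicator measurableSet_Iic, Set.Ioc_inter_Iic, min_eq_right (by linarith)]
  simp [hαβ]

theorem integral_radial_cauchy :
    ∫ r in Set.Ioi (0 : ℝ), r * (1 + r ^ 2) ^ (-(3 : ℝ) / 2) = 1 := by
  have hderiv : ∀ r ∈ Set.Ici (0 : ℝ), HasDerivAt (fun r : ℝ => -(1 + r ^ 2) ^ (-(1 : ℝ) / 2))
      (r * (1 + r ^ 2) ^ (-(3 : ℝ) / 2)) r := by
    intro r _
    have h := (((hasDerivAt_pow 2 r).const_add 1).rpow_const (p := -(1 : ℝ) / 2)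
      (Or.inl (by positivity))).fun_neg
    refine h.congr_deriv ?_
    rw [show -(1 : ℝ) / 2 - 1 = -3 / 2 by norm_num]
    push_cast
    ring
  have hlim : Filter.Tendsto (fun r : ℝ => -(1 + r ^ 2) ^ (-(1 : ℝ) / 2)) Filter.atTop
      (nhds 0) := by
    have h1 : Filter.Tendsto (fun r : ℝ => 1 + r ^ 2) Filter.atTop Filter.atTop :=
      Filter.tendsto_atTop_add_const_left _ _ (Filter.tendsto_pow_atTop two_ne_zero)
    have h2 := ((tendsto_rpow_neg_atTop (y := (1 : ℝ) / 2) (by norm_num)).comp h1).neg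
    simpa [Function.comp_def, neg_div] using h2
  rw [integral_Ioi_of_hasDerivAt_of_nonneg' hderiv
    (fun r hr => mul_nonneg (Set.mem_Ioi.1 hr).le (by positivity)) hlim]
  simp

/-- A radial integral over a planar sector splits into its aperture and a radial integral. -/
theorem setIntegral_planarSector_radial {α β : ℝ} (hαβ : α ≤ β) (h2π : β - α ≤ 2 * π)
    (f : ℝ → ℝ) :
    ∫ p in planarSector α β, f (p.1 ^ 2 + p.2 ^ 2) =
      (∫ r in Set.Ioi (0 : ℝ), r * f (r ^ 2)) * (β - α) := by
  rw [← integral_indicator (measurableSet_planarSector α β), ← integral_comp_polarCoord_symm,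
    ← integral_indicator_sectorAngles hαβ h2π, Measure.volume_eq_prod, polarCoord_target,
    ← setIntegral_prod_mul]
  refine setIntegral_congr_fun (measurableSet_Ioi.prod measurableSet_Ioo) ?_
  rintro ⟨r, θ⟩ ⟨hr, -⟩
  classical
  have hsq : (r * cos θ) ^ 2 + (r * sin θ) ^ 2 = r ^ 2 := by
    linear_combination r ^ 2 * Real.cos_sq_add_sin_sq θ
  simp only [polarCoord_symm_apply, smul_eq_mul, Set.indicator_apply,
    polar_mem_planarSector_iff (Set.mem_Ioi.1 hr), hsq]
  split_ifs <;> simp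

theorem stmt12 (α β : ℝ) (hαβ : α ≤ β) (h2π : β - α ≤ 2 * π) :
    ∫ u in {u : EuclideanSpace ℝ (Fin 2) |
        ∃ r θ : ℝ, 0 < r ∧ α ≤ θ ∧ θ ≤ β ∧
          u 0 = r * Real.cos θ ∧ u 1 = r * Real.sin θ},
      (1 / (2 * π)) * (1 + ‖u‖ ^ 2) ^ (-(3 : ℝ) / 2)
      = (β - α) / (2 * π) := by
  let e := (MeasurableEquiv.toLp 2 (Fin 2 → ℝ)).symm.trans MeasurableEquiv.finTwoArrow
  have he : MeasurePreserving e volume volume :=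
    (volume_preserving_finTwoArrow ℝ).comp
      (EuclideanSpace.volume_preserving_symm_measurableEquiv_toLp (Fin 2))
  have h := he.setIntegral_preimage_emb e.measurableEmbedding
    (fun p => (1 + (p.1 ^ 2 + p.2 ^ 2)) ^ (-(3 : ℝ) / 2)) (planarSector α β)
  rw [setIntegral_planarSector_radial hαβ h2π (fun t => (1 + t) ^ (-(3 : ℝ) / 2)),
    integral_radial_cauchy, one_mul] at h
  rw [integral_const_mul, div_eq_inv_mul (β - α), one_div, ← h]
  simp only [EuclideanSpace.real_norm_sq_eq, Fin.sum_univ_two]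
  rfl
end

section
/- Let C ⊂ ℝ^d be a finite set with d ≥ 1, and let x ∈ C lie in the interior of the convex hull of C. Then geometric collapse occurs: the correct-decision probability satisfies lim_{γ → ∞} ∫_{V(x) − x} f_γ(n) dn = 0. -/
open MeasureTheory Real Filter
open scoped RealInnerProductSpace Topology

/-- Correct-decision probability `P_c(x;γ)`. -/
noncomputable def Pc {d : ℕ} (C : Set (EuclideanSpace ℝ (Fin d)))
    (x : EuclideanSpace ℝ (Fin d)) (γ : ℝ) : ℝ :=
  ∫ n in vorT C x, fC d γ n

theorem two_mul_inner_le_of_mem_vorT {d : ℕ} {C : Set (EuclideanSpace ℝ (Fin d))}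
    {x c n : EuclideanSpace ℝ (Fin d)} (hn : n ∈ vorT C x) (hc : c ∈ C) :
    2 * inner ℝ n (c - x) ≤ ‖c - x‖ ^ 2 := by
  obtain ⟨y, hy, rfl⟩ := hn
  have h := pow_le_pow_left₀ (norm_nonneg _) (hy c hc) 2
  have e : y - c = (y - x) - (c - x) := by abel
  rw [e, norm_sub_sq_real (y - x) (c - x)] at h
  dsimp only
  linarith

/-- A Voronoi cell whose site is interior to the convex hull of the constellation is bounded. -/
theorem isBounded_vorT {d : ℕ} {C : Set (EuclideanSpace ℝ (Fin d))} (hC : C.Finite)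
    {x : EuclideanSpace ℝ (Fin d)} (hint : x ∈ interior (convexHull ℝ C)) :
    Bornology.IsBounded (vorT C x) := by
  obtain ⟨M, hM⟩ := (hC.image fun c => ‖c - x‖ ^ 2).bddAbove
  obtain ⟨r, hr, hball⟩ := Metric.isOpen_iff.mp isOpen_interior x hint
  refine (Metric.isBounded_closedBall (x := 0) (r := M / r)).subset fun n hn => ?_
  have hsub : convexHull ℝ C ⊆ {z | inner ℝ n z ≤ M / 2 + inner ℝ n x} := by
    refine convexHull_min (fun c hc => ?_)
      (convex_halfSpace_le (innerSL ℝ n).toLinearMap.isLinear _)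
    have h₁ := two_mul_inner_le_of_mem_vorT hn hc
    have h₂ : ‖c - x‖ ^ 2 ≤ M := hM ⟨c, hc, rfl⟩
    rw [inner_sub_right] at h₁
    change inner ℝ n c ≤ M / 2 + inner ℝ n x
    linarith
  have hhull : ∀ v : EuclideanSpace ℝ (Fin d), ‖v‖ < r → 2 * inner ℝ n v ≤ M := by
    intro v hv
    have h : inner ℝ n (x + v) ≤ M / 2 + inner ℝ n x :=
      hsub (interior_subset (hball (by simpa using hv)))
    rw [inner_add_right] at h
    linarith
  rw [mem_closedBall_zero_iff, le_div_iff₀ hr]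
  rcases eq_or_ne n 0 with rfl | hn0
  · simpa using hhull 0 (by simpa using hr)
  · have hpos := norm_pos_iff.mpr hn0
    have h := hhull ((r / 2 / ‖n‖) • n) (by
      rw [norm_smul, Real.norm_of_nonneg (by positivity), div_mul_cancel₀ _ hpos.ne']
      linarith)
    rw [real_inner_smul_right, real_inner_self_eq_norm_sq] at h
    calc ‖n‖ * r = 2 * (r / 2 / ‖n‖ * ‖n‖ ^ 2) := by field_simp
      _ ≤ M := h

theorem norm_fC_le (d : ℕ) {γ : ℝ} (hγ : 0 < γ) (n : EuclideanSpace ℝ (Fin d)) :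
    ‖fC d γ n‖ ≤ |cC d| * γ ^ (-(d : ℝ)) := by
  have h₁ : (1 : ℝ) ≤ 1 + ‖n‖ ^ 2 / γ ^ 2 := le_add_of_nonneg_right (by positivity)
  have h₂ : (1 + ‖n‖ ^ 2 / γ ^ 2) ^ (-(((d : ℝ) + 1) / 2)) ≤ 1 :=
    rpow_le_one_of_one_le_of_nonpos h₁ (by linarith [d.cast_nonneg (α := ℝ)])
  rw [fC, norm_mul, norm_mul, Real.norm_eq_abs, Real.norm_of_nonneg (rpow_nonneg hγ.le _),
    Real.norm_of_nonneg (rpow_nonneg (by linarith) _)]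
  exact mul_le_of_le_one_right (by positivity) h₂

theorem stmt14 (d : ℕ) (hd : 1 ≤ d) (C : Set (EuclideanSpace ℝ (Fin d))) (hC : C.Finite)
    (x : EuclideanSpace ℝ (Fin d)) (hx : x ∈ C)
    (hint : x ∈ interior (convexHull ℝ C)) :
    Tendsto (fun γ : ℝ => Pc C x γ) atTop (nhds 0) := by
  have hlim : Tendsto (fun γ : ℝ => |cC d| * γ ^ (-(d : ℝ)) * volume.real (vorT C x))
      atTop (nhds 0) := by
    have hd' : (0 : ℝ) < d := by exact_mod_cast hd
    simpa using ((tendsto_rpow_neg_atTop hd').const_mul |cC d|).mul_const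
      (volume.real (vorT C x))
  refine squeeze_zero_norm' ?_ hlim
  filter_upwards [eventually_gt_atTop 0] with γ hγ
  exact norm_setIntegral_le_of_norm_le_const (isBounded_vorT hC hint).measure_lt_top
    fun n _ => norm_fC_le d hγ n
end
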